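/- arXiv:2207.04233 — 13 statements merged into one kernel-verified Lean document; each statement's English description precedes it below -/
import Mathlib

section
/- (Prime Ideal Principle, left Oka case) Let L be a multiplicative lattice that satisfies the monotonicity condition and is A-generated for some subset A ⊆ L, and let F ⊆ L be a left A-Oka subset. Then every maximal element of L \ F (with respect to ≤) is a prime element of L. -/
open CompleteLattice TopologicalSpace

variable {L : Type*} [CompleteLattice L]

/-- An element `p` of a multiplicative lattice is *prime* if `p ≠ 1` and
`x·y ≤ p` implies `x ≤ p` or `y ≤ p`. -/
def PrimeElt (mul : L → L → L) (p : L) : Prop :=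
  p ≠ ⊤ ∧ ∀ x y : L, mul x y ≤ p → x ≤ p ∨ y ≤ p

/-- Prime Ideal Principle, left `A`-Oka case: every maximal element of `L \ F` is prime. -/
theorem prime_ideal_principle_left_oka (mul : L → L → L)
    (hmul : ∀ x y : L, mul x y ≤ x ⊓ y)
    (hmono : ∀ x y x' y' : L, x ≤ y → x' ≤ y' → mul x x' ≤ mul y y')
    (A : Set L) (hgen : ∀ x : L, ∃ s ⊆ A, x = sSup s)
    (F : Set L) (hF1 : ⊤ ∈ F)
    (hOka : ∀ a ∈ A, ∀ l : L, a ⊔ l ∈ F → sSup {x : L | mul x a ≤ l} ∈ F → l ∈ F)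
    (p : L) (hpF : p ∉ F) (hpmax : ∀ x : L, p < x → x ∈ F) :
    PrimeElt mul p := by
  refine ⟨fun h => hpF (h ▸ hF1), fun x y hxy => ?_⟩
  by_contra! ⟨hx, hy⟩
  obtain ⟨a, haA, hay, hap⟩ : ∃ a ∈ A, a ≤ y ∧ ¬ a ≤ p := by
    obtain ⟨s, hsA, rfl⟩ := hgen y
    by_contra! h
    exact hy (sSup_le fun a ha => h a (hsA ha) (le_sSup ha))
  have hp_le : p ≤ sSup {z : L | mul z a ≤ p} := le_sSup ((hmul p a).trans inf_le_left)
  have hx_le : x ≤ sSup {z : L | mul z a ≤ p} :=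
    le_sSup ((hmono x x a y le_rfl hay).trans hxy)
  exact hpF (hOka a haA p (hpmax _ (right_lt_sup.2 hap))
    (hpmax _ (hp_le.lt_of_not_ge fun h => hx (hx_le.trans h))))
end

section
/- (Prime Ideal Principle, Oka case with associative multiplication) Let L be a multiplicative lattice with associative multiplication that satisfies the monotonicity condition and is A-generated for some subset A ⊆ L, and let F ⊆ L be an A-Oka subset. Then every maximal element of L \ F (with respect to ≤) is a prime element of L. -/
open CompleteLattice TopologicalSpace

variable {L : Type*} [CompleteLattice L]

/-- Prime Ideal Principle, `A`-Oka case with associative multiplication: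
every maximal element of `L \ F` is prime. -/
theorem prime_ideal_principle_oka_assoc (mul : L → L → L)
    (hmul : ∀ x y : L, mul x y ≤ x ⊓ y)
    (hmono : ∀ x y x' y' : L, x ≤ y → x' ≤ y' → mul x x' ≤ mul y y')
    (hassoc : ∀ x y z : L, mul (mul x y) z = mul x (mul y z))
    (A : Set L) (hgen : ∀ x : L, ∃ s ⊆ A, x = sSup s)
    (F : Set L) (hF1 : ⊤ ∈ F)
    (hOka : ∀ a ∈ A, ∀ l : L, a ⊔ l ∈ F →
      sSup {x : L | mul x a ≤ l} ∈ F → sSup {x : L | mul a x ≤ l} ∈ F → l ∈ F)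
    (p : L) (hpF : p ∉ F) (hpmax : ∀ x : L, p < x → x ∈ F) :
    PrimeElt mul p := by
  have mul_le_left (x y : L) : mul x y ≤ x := (hmul x y).trans inf_le_left
  have mul_le_right (x y : L) : mul x y ≤ y := (hmul x y).trans inf_le_right
  have mem_of_not_le {z w : L} (hp : p ≤ w) (hz : z ≤ w) (hzp : ¬ z ≤ p) : w ∈ F :=
    hpmax w (hp.lt_of_ne fun h => hzp (h ▸ hz))
  have exists_gen {x : L} (hx : ¬ x ≤ p) : ∃ a ∈ A, a ≤ x ∧ ¬ a ≤ p := by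
    obtain ⟨s, hs, rfl⟩ := hgen x
    by_contra! h
    exact hx (sSup_le fun a ha => h a (hs ha) (le_sSup ha))
  -- An element of `A` not below `p` cannot be both a left and a right zero divisor modulo `p`.
  have oka {a u v : L} (ha : a ∈ A) (hap : ¬ a ≤ p) (hu : mul u a ≤ p) (hup : ¬ u ≤ p)
      (hv : mul a v ≤ p) (hvp : ¬ v ≤ p) : False :=
    hpF <| hOka a ha p (mem_of_not_le le_sup_right le_sup_left hap)
      (mem_of_not_le (le_sSup (mul_le_left p a)) (le_sSup hu) hup)
      (mem_of_not_le (le_sSup (mul_le_right a p)) (le_sSup hv) hvp)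
  refine ⟨fun h => hpF (h ▸ hF1), fun x y hxy => ?_⟩
  by_contra! h
  obtain ⟨a, haA, hax, hap⟩ := exists_gen h.1
  obtain ⟨b, hbA, hby, hbp⟩ := exists_gen h.2
  have hab : mul a b ≤ p := (hmono _ _ _ _ hax hby).trans hxy
  have hba : ¬ mul b a ≤ p := fun hba => oka haA hap hba hbp hab hbp
  obtain ⟨c, hcA, hc, hcp⟩ := exists_gen hba
  have hcc : mul c c ≤ p := by
    refine (hmono _ _ _ _ hc hc).trans ?_
    rw [hassoc, ← hassoc a b a]
    exact (mul_le_right _ _).trans ((mul_le_left _ _).trans hab)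
  exact oka hcA hcp hcc hcp hcc hcp
end

section
/- (Prime Ideal Principle, Ako case) Let L be a multiplicative lattice that satisfies the monotonicity condition and is A-generated for some subset A ⊆ L, and let F ⊆ L be an A-Ako subset. Then every maximal element of L \ F (with respect to ≤) is a prime element of L. -/
open CompleteLattice TopologicalSpace

variable {L : Type*} [CompleteLattice L]

/-- Prime Ideal Principle, `A`-Ako case: every maximal element of `L \ F` is prime. -/
theorem prime_ideal_principle_ako (mul : L → L → L)
    (hmul : ∀ x y : L, mul x y ≤ x ⊓ y)
    (hmono : ∀ x y x' y' : L, x ≤ y → x' ≤ y' → mul x x' ≤ mul y y')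
    (A : Set L) (hgen : ∀ x : L, ∃ s ⊆ A, x = sSup s)
    (F : Set L) (hF1 : ⊤ ∈ F)
    (hAko : ∀ l : L, ∀ a ∈ A, ∀ b ∈ A, l ⊔ a ∈ F → l ⊔ b ∈ F → l ⊔ mul a b ∈ F)
    (p : L) (hpF : p ∉ F) (hpmax : ∀ x : L, p < x → x ∈ F) :
    PrimeElt mul p := by
  have exists_le : ∀ x : L, ¬ x ≤ p → ∃ a ∈ A, a ≤ x ∧ ¬ a ≤ p := by
    intro x hx
    obtain ⟨s, hsA, rfl⟩ := hgen x
    by_contra! h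
    exact hx (sSup_le fun a ha => h a (hsA ha) (le_sSup ha))
  refine ⟨fun h => hpF (h ▸ hF1), fun x y hxy => ?_⟩
  by_contra! h
  obtain ⟨a, haA, hax, hap⟩ := exists_le x h.1
  obtain ⟨b, hbA, hby, hbp⟩ := exists_le y h.2
  have hab : mul a b ≤ p := (hmono a x b y hax hby).trans hxy
  have hF := hAko p a haA b hbA (hpmax _ (left_lt_sup.2 hap)) (hpmax _ (left_lt_sup.2 hbp))
  exact hpF (sup_eq_left.2 hab ▸ hF)
end

section
/- Let L be an m-distributive multiplicative lattice, let S be an m-system in L, and let Σ := {l ∈ L : s ≰ l for every s ∈ S}. Then L \ Σ is a C(L)-Ako subset of L. -/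
open CompleteLattice TopologicalSpace

variable {L : Type*} [CompleteLattice L]

/-- An *m-system* in a multiplicative lattice: a nonempty set of compact elements such that
for all `x, y ∈ S` there is `z ∈ S` with `z ≤ x·y`. -/
def IsMSystem (mul : L → L → L) (S : Set L) : Prop :=
  S.Nonempty ∧ (∀ s ∈ S, IsCompactElement s) ∧
    ∀ x ∈ S, ∀ y ∈ S, ∃ z ∈ S, z ≤ mul x y

/-- A set `S` of compact elements is *saturated* if `x ∈ S`, `c` compact and `x ≤ c`
imply `c ∈ S`. -/
def IsSaturated (S : Set L) : Prop :=
  ∀ x ∈ S, ∀ c : L, IsCompactElement c → x ≤ c → c ∈ S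

/-- A set `F ⊆ L` is an `A`-Ako subset if `1 ∈ F` and `l ⊔ a ∈ F`, `l ⊔ b ∈ F` imply
`l ⊔ a·b ∈ F` for all `l ∈ L` and `a, b ∈ A`. -/
def IsAko (mul : L → L → L) (A F : Set L) : Prop :=
  ⊤ ∈ F ∧ ∀ l : L, ∀ a ∈ A, ∀ b ∈ A, l ⊔ a ∈ F → l ⊔ b ∈ F → l ⊔ mul a b ∈ F

theorem mul_le_mul_of_distrib (mul : L → L → L)
    (hdistl : ∀ x y z : L, mul (x ⊔ y) z = mul x z ⊔ mul y z)
    (hdistr : ∀ x y z : L, mul x (y ⊔ z) = mul x y ⊔ mul x z)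
    {x x' y y' : L} (hx : x ≤ x') (hy : y ≤ y') : mul x y ≤ mul x' y' := by
  rw [← sup_eq_right.2 hx, ← sup_eq_right.2 hy, hdistl, hdistr]
  exact le_sup_of_le_left le_sup_left

theorem mul_sup_sup_le (mul : L → L → L)
    (hmul : ∀ x y : L, mul x y ≤ x ⊓ y)
    (hdistl : ∀ x y z : L, mul (x ⊔ y) z = mul x z ⊔ mul y z)
    (hdistr : ∀ x y z : L, mul x (y ⊔ z) = mul x y ⊔ mul x z)
    (l a b : L) : mul (l ⊔ a) (l ⊔ b) ≤ l ⊔ mul a b := by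
  rw [hdistl, hdistr a]
  exact sup_le (le_sup_of_le_left ((hmul _ _).trans inf_le_left))
    (sup_le_sup_right ((hmul _ _).trans inf_le_right) _)

/-- If `L` is m-distributive and `S` is an m-system, then the complement of
`Σ := {l | s ≰ l for all s ∈ S}` is a `C(L)`-Ako subset of `L`. -/
theorem compl_sigma_isAko (mul : L → L → L)
    (hmul : ∀ x y : L, mul x y ≤ x ⊓ y)
    (hdistl : ∀ x y z : L, mul (x ⊔ y) z = mul x z ⊔ mul y z)
    (hdistr : ∀ x y z : L, mul x (y ⊔ z) = mul x y ⊔ mul x z)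
    (S : Set L) (hS : IsMSystem mul S) :
    IsAko mul {c : L | IsCompactElement c} ({l : L | ∀ s ∈ S, ¬ s ≤ l}ᶜ) := by
  simp only [IsAko, Set.mem_compl_iff, Set.mem_ofPred_eq, not_forall, not_not, exists_prop]
  obtain ⟨⟨s₀, hs₀⟩, -, hS⟩ := hS
  refine ⟨⟨s₀, hs₀, le_top⟩, ?_⟩
  rintro l a - b - ⟨s, hs, hsa⟩ ⟨t, ht, htb⟩
  obtain ⟨z, hz, hzst⟩ := hS s hs t ht
  exact ⟨z, hz, hzst.trans ((mul_le_mul_of_distrib mul hdistl hdistr hsa htb).trans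
    (mul_sup_sup_le mul hmul hdistl hdistr l a b))⟩
end

section
/- Let L be an algebraic m-distributive multiplicative lattice, let S be an m-system in L, and let Σ := {l ∈ L : s ≰ l for every s ∈ S}. Then every maximal element of Σ (with respect to ≤) is a prime element of L. -/
open CompleteLattice TopologicalSpace

variable {L : Type*} [CompleteLattice L]

/-- In an algebraic m-distributive multiplicative lattice, every maximal element of
`Σ := {l | s ≰ l for all s ∈ S}` (for an m-system `S`) is prime. -/
theorem sigma_maximal_is_prime (mul : L → L → L)
    (hmul : ∀ x y : L, mul x y ≤ x ⊓ y)
    (hdistl : ∀ x y z : L, mul (x ⊔ y) z = mul x z ⊔ mul y z)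
    (hdistr : ∀ x y z : L, mul x (y ⊔ z) = mul x y ⊔ mul x z)
    (halg : ∀ x : L, ∃ s : Set L, (∀ c ∈ s, IsCompactElement c) ∧ x = sSup s)
    (S : Set L) (hS : IsMSystem mul S)
    (p : L) (hpSigma : ∀ s ∈ S, ¬ s ≤ p)
    (hpmax : ∀ x : L, (∀ s ∈ S, ¬ s ≤ x) → p ≤ x → x = p) :
    PrimeElt mul p := by
  obtain ⟨⟨s₀, hs₀⟩, -, hprod⟩ := hS
  have exists_le_sup : ∀ x : L, ¬ x ≤ p → ∃ s ∈ S, s ≤ p ⊔ x := by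
    intro x hx
    by_contra! h
    exact hx (sup_eq_left.mp (hpmax (p ⊔ x) h le_sup_left))
  refine ⟨fun h => hpSigma s₀ hs₀ (h ▸ le_top), fun x y hxy => ?_⟩
  by_contra! h
  obtain ⟨s, hs, hsx⟩ := exists_le_sup x h.1
  obtain ⟨t, ht, hty⟩ := exists_le_sup y h.2
  obtain ⟨z, hz, hzst⟩ := hprod s hs t ht
  have mul_mono : mul s t ≤ mul (p ⊔ x) (p ⊔ y) := by
    rw [← sup_eq_right.mpr hsx, ← sup_eq_right.mpr hty, hdistl, hdistr]
    exact le_sup_left.trans le_sup_left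
  refine hpSigma z hz (hzst.trans (mul_mono.trans ?_))
  rw [hdistl, hdistr x]
  exact sup_le ((hmul _ _).trans inf_le_left)
    (sup_le ((hmul _ _).trans inf_le_right) hxy)
end

section
/- Let L be an m-distributive multiplicative lattice and let l ∈ L. Then an element p of the interval [l,1] is a prime element of the multiplicative lattice ([l,1], ∨, *) if and only if p is a prime element of L; that is, Spec([l,1]) = V_L(l). In particular, 0 (= l) is a prime element of ([l,1], ∨, *) if and only if l ∈ Spec(L). -/
open CompleteLattice TopologicalSpace

variable {L : Type*} [CompleteLattice L]

/-- For `l ≤ p`, primeness of `p` can be tested on elements above `l`, with the multiplication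
`mul x y ⊔ l`. -/
theorem primeElt_iff_of_le (mul : L → L → L)
    (hmul : ∀ x y : L, mul x y ≤ x ⊓ y)
    (hdistl : ∀ x y z : L, mul (x ⊔ y) z = mul x z ⊔ mul y z)
    (hdistr : ∀ x y z : L, mul x (y ⊔ z) = mul x y ⊔ mul x z)
    {l p : L} (hlp : l ≤ p) :
    (p ≠ ⊤ ∧ ∀ x y : L, l ≤ x → l ≤ y → mul x y ⊔ l ≤ p → x ≤ p ∨ y ≤ p) ↔
      PrimeElt mul p := by
  refine and_congr_right fun _ => ⟨fun h x y hxy => ?_, fun h x y _ _ hxy =>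
    h x y (le_sup_left.trans hxy)⟩
  have hl : mul l (y ⊔ l) ≤ p := (hmul _ _).trans (inf_le_left.trans hlp)
  have hr : mul x l ≤ p := (hmul _ _).trans (inf_le_right.trans hlp)
  have hprod : mul (x ⊔ l) (y ⊔ l) ⊔ l ≤ p := by
    rw [hdistl, hdistr x]
    exact sup_le (sup_le (sup_le hxy hr) hl) hlp
  exact (h _ _ le_sup_right le_sup_right hprod).imp le_sup_left.trans le_sup_left.trans

/-- In an m-distributive multiplicative lattice, an element `p` of the interval `[l,1]`
(with multiplication `z * z' = z·z' ⊔ l`) is prime in `[l,1]` iff it is prime in `L`;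
in particular the bottom `l` of `[l,1]` is prime in `[l,1]` iff `l ∈ Spec(L)`. -/
theorem interval_spec_eq_V (mul : L → L → L)
    (hmul : ∀ x y : L, mul x y ≤ x ⊓ y)
    (hdistl : ∀ x y z : L, mul (x ⊔ y) z = mul x z ⊔ mul y z)
    (hdistr : ∀ x y z : L, mul x (y ⊔ z) = mul x y ⊔ mul x z)
    (l : L) :
    (∀ p : L, l ≤ p →
      ((p ≠ ⊤ ∧ ∀ x y : L, l ≤ x → l ≤ y → mul x y ⊔ l ≤ p → x ≤ p ∨ y ≤ p) ↔
        PrimeElt mul p)) ∧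
    ((l ≠ ⊤ ∧ ∀ x y : L, l ≤ x → l ≤ y → mul x y ⊔ l ≤ l → x ≤ l ∨ y ≤ l) ↔
      PrimeElt mul l) := by
  exact ⟨fun p hlp => primeElt_iff_of_le mul hmul hdistl hdistr hlp,
    primeElt_iff_of_le mul hmul hdistl hdistr le_rfl⟩
end

section
/- Let L be an algebraic m-distributive multiplicative lattice and let Y ⊆ Spec(L) be a compact subspace with respect to the Zariski topology. Then S_Y := {c ∈ C(L) : c ≰ p for all p ∈ Y} is a saturated m-system in L. -/
open CompleteLattice TopologicalSpace

variable {L : Type*} [CompleteLattice L]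

/-- The prime spectrum of a multiplicative lattice, as a type. -/
abbrev SpecL (mul : L → L → L) : Type _ := {p : L // PrimeElt mul p}

/-- The Zariski-closed set `V(x) = {p ∈ Spec L | x ≤ p}`. -/
def Vset (mul : L → L → L) (x : L) : Set (SpecL mul) := {p : SpecL mul | x ≤ p.1}

/-- The Zariski topology on the prime spectrum: the closed sets are the `V(x)`. -/
instance (mul : L → L → L) : TopologicalSpace (SpecL mul) :=
  generateFrom {U : Set (SpecL mul) | ∃ x : L, U = (Vset mul x)ᶜ}

/-- If `z` lies below no point of a compact set `Y` of primes, then some compact element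
below `z` lies below no point of `Y`. -/
theorem exists_isCompactElement_le_of_isCompact (mul : L → L → L)
    (halg : ∀ x : L, ∃ s : Set L, (∀ c ∈ s, IsCompactElement c) ∧ x = sSup s)
    {Y : Set (SpecL mul)} (hY : IsCompact Y) {z : L} (hz : ∀ p ∈ Y, ¬ z ≤ p.1) :
    ∃ c ≤ z, IsCompactElement c ∧ ∀ p ∈ Y, ¬ c ≤ p.1 := by
  obtain ⟨s, hs, rfl⟩ := halg z
  obtain ⟨t, ht⟩ := hY.elim_finite_subcover (fun c : s => (Vset mul c.1)ᶜ)
    (fun c => isOpen_generateFrom_of_mem ⟨c.1, rfl⟩) (by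
      intro p hp
      by_contra hcov
      simp only [Set.mem_iUnion, not_exists, Set.notMem_compl_iff] at hcov
      exact hz p hp (sSup_le fun c hc => hcov ⟨c, hc⟩))
  refine ⟨t.sup (fun c : s => c.1), Finset.sup_le fun c _ => le_sSup c.2,
    isCompactElement_finsetSup _ fun c _ => hs c.1 c.2, fun p hp hle => ?_⟩
  obtain ⟨c, hct, hc⟩ := Set.mem_iUnion₂.mp (ht hp)
  exact hc ((Finset.le_sup (f := fun c : s => c.1) hct).trans hle)

/-- If `L` is an algebraic m-distributive multiplicative lattice and `Y ⊆ Spec L` is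
compact in the Zariski topology, then `S_Y := {c ∈ C(L) | c ≰ p for all p ∈ Y}` is a
saturated m-system. -/
theorem compact_subset_saturated_msystem (mul : L → L → L)
    (hmul : ∀ x y : L, mul x y ≤ x ⊓ y)
    (hdistl : ∀ x y z : L, mul (x ⊔ y) z = mul x z ⊔ mul y z)
    (hdistr : ∀ x y z : L, mul x (y ⊔ z) = mul x y ⊔ mul x z)
    (halg : ∀ x : L, ∃ s : Set L, (∀ c ∈ s, IsCompactElement c) ∧ x = sSup s)
    (Y : Set (SpecL mul)) (hY : IsCompact Y) :
    IsMSystem mul {c : L | IsCompactElement c ∧ ∀ p ∈ Y, ¬ c ≤ p.1} ∧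
      IsSaturated {c : L | IsCompactElement c ∧ ∀ p ∈ Y, ¬ c ≤ p.1} := by
  refine ⟨⟨?_, fun c hc => hc.1, ?_⟩,
    fun x hx c hc hxc => ⟨hc, fun p hp hcp => hx.2 p hp (hxc.trans hcp)⟩⟩
  · obtain ⟨c, -, hc⟩ := exists_isCompactElement_le_of_isCompact mul halg hY (z := ⊤)
      fun p _ hp => p.2.1 (top_le_iff.mp hp)
    exact ⟨c, hc⟩
  · intro x hx y hy
    obtain ⟨c, hle, hc⟩ := exists_isCompactElement_le_of_isCompact mul halg hY (z := mul x y)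
      fun p hp h => (p.2.2 x y h).elim (hx.2 p hp) (hy.2 p hp)
    exact ⟨c, hc, hle⟩
end

section
/- Let L be a multiplicative lattice and let 𝒯 be the topology on Spec(L) whose open sets are generated by the sets V(c), for c ∈ C(L), as basic open sets. Then, for subsets X, Y ⊆ Spec(L), one has S_X = S_Y if and only if cl_𝒯(X) = cl_𝒯(Y), where S_X := {c ∈ C(L) : c ≰ p for all p ∈ X} and cl_𝒯 denotes closure with respect to 𝒯. -/
open CompleteLattice TopologicalSpace

variable {L : Type*} [CompleteLattice L]

theorem IsCompactElement.of_bot : IsCompactElement (⊥ : L) :=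
  fun _ _ ⟨x, hx⟩ _ _ _ => ⟨x, hx, bot_le⟩

theorem IsCompactElement.sup {c d : L} (hc : IsCompactElement c) (hd : IsCompactElement d) :
    IsCompactElement (c ⊔ d) := by
  intro s u hne hdir hu hle
  obtain ⟨x, hx, hcx⟩ := hc s u hne hdir hu (le_sup_left.trans hle)
  obtain ⟨y, hy, hdy⟩ := hd s u hne hdir hu (le_sup_right.trans hle)
  obtain ⟨z, hz, hxz, hyz⟩ := hdir x hx y hy
  exact ⟨z, hz, sup_le (hcx.trans hxz) (hdy.trans hyz)⟩

theorem Vset_inter (mul : L → L → L) (c d : L) : Vset mul c ∩ Vset mul d = Vset mul (c ⊔ d) :=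
  Set.ext fun _ => sup_le_iff.symm

/-- The sets `V(c)`, `c` compact, form a basis of the topology they generate. -/
theorem isTopologicalBasis_Vset (mul : L → L → L) :
    @IsTopologicalBasis _
      (generateFrom {U : Set (SpecL mul) | ∃ c : L, IsCompactElement c ∧ U = Vset mul c})
      {U : Set (SpecL mul) | ∃ c : L, IsCompactElement c ∧ U = Vset mul c} := by
  let _ := generateFrom {U : Set (SpecL mul) | ∃ c : L, IsCompactElement c ∧ U = Vset mul c}
  refine ⟨?_, Set.sUnion_eq_univ_iff.2 fun p => ⟨_, ⟨⊥, .of_bot, rfl⟩, bot_le (a := p.1)⟩, rfl⟩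
  rintro _ ⟨c, hc, rfl⟩ _ ⟨d, hd, rfl⟩ p hp
  exact ⟨_, ⟨c ⊔ d, hc.sup hd, Vset_inter mul c d⟩, hp, subset_rfl⟩

theorem mem_closure_iff_forall_compact_le (mul : L → L → L) (X : Set (SpecL mul))
    (p : SpecL mul) :
    p ∈ @closure _ (generateFrom
        {U : Set (SpecL mul) | ∃ c : L, IsCompactElement c ∧ U = Vset mul c}) X ↔
      ∀ c : L, IsCompactElement c → c ≤ p.1 → ∃ q ∈ X, c ≤ q.1 := by
  let _ := generateFrom {U : Set (SpecL mul) | ∃ c : L, IsCompactElement c ∧ U = Vset mul c}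
  rw [(isTopologicalBasis_Vset mul).mem_closure_iff]
  constructor
  · intro h c hc hcp
    obtain ⟨q, hcq, hq⟩ := h _ ⟨c, hc, rfl⟩ hcp
    exact ⟨q, hq, hcq⟩
  · rintro h _ ⟨c, hc, rfl⟩ hcp
    obtain ⟨q, hq, hcq⟩ := h c hc hcp
    exact ⟨q, hcq, hq⟩

/-- A compact element lies below some element of the closure of `X` iff it lies below some
element of `X`. -/
theorem exists_mem_closure_le_iff (mul : L → L → L) (X : Set (SpecL mul)) {c : L}
    (hc : IsCompactElement c) :
    (∃ p ∈ @closure _ (generateFrom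
        {U : Set (SpecL mul) | ∃ c : L, IsCompactElement c ∧ U = Vset mul c}) X, c ≤ p.1) ↔
      ∃ p ∈ X, c ≤ p.1 := by
  refine ⟨fun ⟨p, hp, hcp⟩ => (mem_closure_iff_forall_compact_le mul X p).1 hp c hc hcp,
    fun ⟨p, hp, hcp⟩ => ⟨p, ?_, hcp⟩⟩
  exact (mem_closure_iff_forall_compact_le mul X p).2 fun _ _ h => ⟨p, hp, h⟩

/-- For subsets `X, Y ⊆ Spec L`, `S_X = S_Y` iff `X` and `Y` have the same closure in the
topology `𝒯` generated by the sets `V(c)`, `c` compact, as basic open sets. -/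
theorem SX_eq_SY_iff_closure_eq (mul : L → L → L)
    (hmul : ∀ x y : L, mul x y ≤ x ⊓ y)
    (X Y : Set (SpecL mul)) :
    ({c : L | IsCompactElement c ∧ ∀ p ∈ X, ¬ c ≤ p.1} =
        {c : L | IsCompactElement c ∧ ∀ p ∈ Y, ¬ c ≤ p.1}) ↔
      (@closure _ (generateFrom
          {U : Set (SpecL mul) | ∃ c : L, IsCompactElement c ∧ U = Vset mul c}) X =
        @closure _ (generateFrom
          {U : Set (SpecL mul) | ∃ c : L, IsCompactElement c ∧ U = Vset mul c}) Y) := by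
  have key : ({c : L | IsCompactElement c ∧ ∀ p ∈ X, ¬ c ≤ p.1} =
      {c : L | IsCompactElement c ∧ ∀ p ∈ Y, ¬ c ≤ p.1}) ↔
      ∀ c : L, IsCompactElement c → ((∃ p ∈ X, c ≤ p.1) ↔ ∃ p ∈ Y, c ≤ p.1) := by
    simp only [Set.ext_iff, Set.mem_ofPred_eq, and_congr_right_iff]
    refine forall₂_congr fun c _ => ?_
    rw [← not_iff_not (a := ∃ p ∈ X, c ≤ p.1)]
    push Not
    rfl
  rw [key]
  constructor
  · intro h
    ext p
    simp only [mem_closure_iff_forall_compact_le]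
    exact forall₃_congr fun c hc _ => h c hc
  · intro h c hc
    rw [← exists_mem_closure_le_iff mul X hc, h, exists_mem_closure_le_iff mul Y hc]
end

section
/- Let L be an algebraic m-distributive multiplicative lattice and X ⊆ Spec(L). Then S_X := {c ∈ C(L) : c ≰ p for all p ∈ X} is a saturated m-system if and only if cl_𝒯(X) is compact with respect to the Zariski topology, where 𝒯 is the topology on Spec(L) whose open sets are generated by the sets V(c), c ∈ C(L), and cl_𝒯 denotes closure with respect to 𝒯. -/
open CompleteLattice TopologicalSpace

variable {L : Type*} [CompleteLattice L]

theorem mem_closure_generateFrom_iff {α : Type*} {B : Set (Set α)} (huniv : Set.univ ∈ B)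
    (hinter : ∀ u ∈ B, ∀ v ∈ B, u ∩ v ∈ B) {X : Set α} {a : α} :
    a ∈ @closure α (generateFrom B) X ↔ ∀ u ∈ B, a ∈ u → (u ∩ X).Nonempty := by
  let := generateFrom B
  have hB : IsTopologicalBasis B :=
    { exists_subset_inter := fun u hu v hv x hx => ⟨u ∩ v, hinter u hu v hv, hx, subset_rfl⟩
      sUnion_eq := Set.eq_univ_of_univ_subset (Set.subset_sUnion_of_mem huniv)
      eq_generateFrom := rfl }
  exact hB.mem_closure_iff

/-- A point lies in the `𝒯`-closure of `X` iff every compact element below it lies below some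
point of `X`. -/
theorem mem_closure_Vset_iff {mul : L → L → L} {X : Set (SpecL mul)} {q : SpecL mul} :
    q ∈ @closure _ (generateFrom
        {U : Set (SpecL mul) | ∃ c : L, IsCompactElement c ∧ U = Vset mul c}) X ↔
      ∀ c : L, IsCompactElement c → c ≤ q.1 → ∃ p ∈ X, c ≤ p.1 := by
  rw [mem_closure_generateFrom_iff]
  · constructor
    · intro h c hc hcq
      obtain ⟨p, hp, hpX⟩ := h _ ⟨c, hc, rfl⟩ hcq
      exact ⟨p, hpX, hp⟩
    · rintro h _ ⟨c, hc, rfl⟩ hcq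
      obtain ⟨p, hpX, hp⟩ := h c hc hcq
      exact ⟨p, hp, hpX⟩
  · refine ⟨⊥, ?_, by ext p; simp [Vset]⟩
    simpa using isCompactElement_finsetSup (s := (∅ : Finset L)) (f := id) (by simp)
  · classical
    rintro _ ⟨c, hc, rfl⟩ _ ⟨d, hd, rfl⟩
    refine ⟨c ⊔ d, ?_, by ext p; simp [Vset]⟩
    simpa using isCompactElement_finsetSup (s := {c, d}) (f := id) (by simp [hc, hd])

theorem IsCompact.exists_isCompactElement_le {mul : L → L → L} [IsCompactlyGenerated L]
    {Y : Set (SpecL mul)} (hY : IsCompact Y) {x : L} (hx : ∀ p ∈ Y, ¬ x ≤ p.1) :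
    ∃ c : L, IsCompactElement c ∧ c ≤ x ∧ ∀ p ∈ Y, ¬ c ≤ p.1 := by
  obtain ⟨t, ht⟩ := hY.elim_finite_subcover
    (fun c : {c : L // IsCompactElement c ∧ c ≤ x} => (Vset mul c.1)ᶜ)
    (fun c => isOpen_generateFrom_of_mem ⟨c.1, rfl⟩) (by
      intro p hp
      by_contra hcon
      refine hx p hp (le_iff_compact_le_imp.2 fun c hc hcx => ?_)
      by_contra hcp
      exact hcon (Set.mem_iUnion.2 ⟨⟨c, hc, hcx⟩, hcp⟩))
  refine ⟨t.sup Subtype.val, isCompactElement_finsetSup _ fun c _ => c.2.1,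
    Finset.sup_le fun c _ => c.2.2, fun p hp hcp => ?_⟩
  obtain ⟨c, hct, hc⟩ := Set.mem_iUnion₂.1 (ht hp)
  exact hc ((Finset.le_sup (f := Subtype.val) hct).trans hcp)

/-- Krull's separation lemma: an element with no member of the m-system `S` below it lies below a
prime with the same property. -/
theorem IsMSystem.exists_prime_le {mul : L → L → L} (hmul : ∀ x y : L, mul x y ≤ x ⊓ y)
    (hdistl : ∀ x y z : L, mul (x ⊔ y) z = mul x z ⊔ mul y z)
    (hdistr : ∀ x y z : L, mul x (y ⊔ z) = mul x y ⊔ mul x z)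
    {S : Set L} (hS : IsMSystem mul S) {a : L} (ha : ∀ c ∈ S, ¬ c ≤ a) :
    ∃ q : L, PrimeElt mul q ∧ a ≤ q ∧ ∀ c ∈ S, ¬ c ≤ q := by
  obtain ⟨⟨s, hs⟩, hcomp, hms⟩ := hS
  obtain ⟨q, haq, hq, hmax⟩ := zorn_le_nonempty₀ {b : L | ∀ c ∈ S, ¬ c ≤ b} (by
    intro C hC hchain y hy
    refine ⟨sSup C, fun c hc hle => ?_, fun z hz => le_sSup hz⟩
    obtain ⟨b, hb, hcb⟩ := hcomp c hc C _ ⟨y, hy⟩ hchain.directedOn (_root_.isLUB_sSup C) hle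
    exact hC hb c hc hcb) a ha
  have hsup : ∀ x : L, ¬ x ≤ q → ∃ c ∈ S, c ≤ q ⊔ x := by
    intro x hx
    by_contra! hcon
    exact hx (le_sup_right.trans (hmax hcon le_sup_left))
  refine ⟨q, ⟨fun h => hq s hs (h ▸ le_top), fun x y hxy => ?_⟩, haq, hq⟩
  by_contra! hcon
  obtain ⟨c, hc, hcx⟩ := hsup x hcon.1
  obtain ⟨d, hd, hdy⟩ := hsup y hcon.2
  obtain ⟨z, hz, hzcd⟩ := hms c hc d hd
  have hmono : mul c d ≤ mul (q ⊔ x) (q ⊔ y) := by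
    rw [← sup_eq_right.2 hcx, ← sup_eq_right.2 hdy, hdistl, hdistr]
    exact le_sup_left.trans le_sup_left
  refine hq z hz (hzcd.trans (hmono.trans ?_))
  rw [hdistl, hdistr, hdistr]
  exact sup_le (sup_le ((hmul _ _).trans inf_le_left) ((hmul _ _).trans inf_le_left))
    (sup_le ((hmul _ _).trans inf_le_right) hxy)

/-- For `X ⊆ Spec L` in an algebraic m-distributive multiplicative lattice, `S_X` is a
saturated m-system iff the closure of `X` in the topology `𝒯` (generated by the sets
`V(c)`, `c` compact, as basic open sets) is compact in the Zariski topology. -/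
theorem SX_saturated_msystem_iff_closure_compact (mul : L → L → L)
    (hmul : ∀ x y : L, mul x y ≤ x ⊓ y)
    (hdistl : ∀ x y z : L, mul (x ⊔ y) z = mul x z ⊔ mul y z)
    (hdistr : ∀ x y z : L, mul x (y ⊔ z) = mul x y ⊔ mul x z)
    (halg : ∀ x : L, ∃ s : Set L, (∀ c ∈ s, IsCompactElement c) ∧ x = sSup s)
    (X : Set (SpecL mul)) :
    (IsMSystem mul {c : L | IsCompactElement c ∧ ∀ p ∈ X, ¬ c ≤ p.1} ∧
        IsSaturated {c : L | IsCompactElement c ∧ ∀ p ∈ X, ¬ c ≤ p.1}) ↔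
      IsCompact (@closure _ (generateFrom
        {U : Set (SpecL mul) | ∃ c : L, IsCompactElement c ∧ U = Vset mul c}) X) := by
  have : IsCompactlyGenerated L := ⟨fun x => by
    obtain ⟨s, hs, hx⟩ := halg x
    exact ⟨s, hs, hx.symm⟩⟩
  constructor
  · rintro ⟨hS, -⟩
    refine isCompact_generateFrom rfl fun P hP hcover => ?_
    obtain ⟨c, ⟨hc, hcX⟩, hcA⟩ : ∃ c ∈ {c : L | IsCompactElement c ∧ ∀ p ∈ X, ¬ c ≤ p.1},
        c ≤ sSup {x : L | (Vset mul x)ᶜ ∈ P} := by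
      by_contra! hcon
      obtain ⟨q, hq, hAq, hqS⟩ := hS.exists_prime_le hmul hdistl hdistr hcon
      have hqX := (mem_closure_Vset_iff (X := X) (q := ⟨q, hq⟩)).2 fun c hc hcq => by
        by_contra! hcX
        exact hqS c ⟨hc, hcX⟩ hcq
      obtain ⟨U, hU, hqU⟩ := hcover hqX
      obtain ⟨x, rfl⟩ := hP hU
      have hxA : x ≤ sSup {x : L | (Vset mul x)ᶜ ∈ P} := le_sSup hU
      exact hqU (hxA.trans hAq)
    obtain ⟨t, htA, hct⟩ := (isCompactElement_iff_exists_le_sSup_of_le_sSup L c).1 hc _ hcA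
    refine ⟨(fun x => (Vset mul x)ᶜ) '' t, ?_, t.finite_toSet.image _, fun p hp => ?_⟩
    · rintro _ ⟨x, hx, rfl⟩
      exact htA hx
    · by_contra hcon
      obtain ⟨r, hr, hcr⟩ := mem_closure_Vset_iff.1 hp c hc (hct.trans (Finset.sup_le fun x hx => by
        by_contra hxp
        exact hcon ⟨_, ⟨x, hx, rfl⟩, hxp⟩))
      exact hcX r hr hcr
  · intro hY
    have hcompact : ∀ x : L, (∀ p : SpecL mul, (∀ c, IsCompactElement c → c ≤ p.1 →
        ∃ r ∈ X, c ≤ r.1) → ¬ x ≤ p.1) →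
        ∃ c : L, (IsCompactElement c ∧ ∀ p ∈ X, ¬ c ≤ p.1) ∧ c ≤ x := by
      intro x hx
      obtain ⟨c, hc, hcx, hcY⟩ := hY.exists_isCompactElement_le
        fun p hp => hx p (mem_closure_Vset_iff.1 hp)
      exact ⟨c, ⟨hc, fun p hp => hcY p (mem_closure_Vset_iff.2 fun _ _ h => ⟨p, hp, h⟩)⟩, hcx⟩
    refine ⟨⟨?_, fun s hs => hs.1, ?_⟩, fun x hx c hc hxc => ⟨hc, fun p hp hcp =>
      hx.2 p hp (hxc.trans hcp)⟩⟩
    · obtain ⟨c, hc, -⟩ := hcompact ⊤ fun p _ h => p.2.1 (top_le_iff.1 h)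
      exact ⟨c, hc⟩
    · rintro x ⟨hx, hxX⟩ y ⟨hy, hyX⟩
      refine hcompact _ fun p hp hxy => ?_
      rcases p.2.2 x y hxy with h | h
      · obtain ⟨r, hr, hxr⟩ := hp x hx h
        exact hxX r hr hxr
      · obtain ⟨r, hr, hyr⟩ := hp y hy h
        exact hyX r hr hyr
end

section
/- Let L₁ and L₂ be multiplicative lattices and let L₁ × L₂ be their direct product, with componentwise order and multiplication (ℓ₁,ℓ₂)·(ℓ₁',ℓ₂') = (ℓ₁·ℓ₁', ℓ₂·ℓ₂'). Then an element (p₁,p₂) ∈ L₁ × L₂ is prime if and only if either p₂ = 1 and p₁ is prime in L₁, or p₁ = 1 and p₂ is prime in L₂. Consequently, Spec(L₁ × L₂) is the disjoint union of the two clopen subsets V((0,1)) and V((1,0)), and the maps p₁ ↦ (p₁,1) and p₂ ↦ (1,p₂) are homeomorphisms of Spec(L₁) onto V((0,1)) and of Spec(L₂) onto V((1,0)), respectively. -/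
open CompleteLattice TopologicalSpace

variable {L : Type*} [CompleteLattice L]

/-- The componentwise multiplication on the direct product of two multiplicative lattices. -/
def prodMul {L₁ L₂ : Type*} (mul₁ : L₁ → L₁ → L₁) (mul₂ : L₂ → L₂ → L₂) :
    L₁ × L₂ → L₁ × L₂ → L₁ × L₂ :=
  fun x y => (mul₁ x.1 y.1, mul₂ x.2 y.2)

theorem isClosed_Vset (mul : L → L → L) (x : L) : IsClosed (Vset mul x) :=
  ⟨isOpen_generateFrom_of_mem ⟨x, rfl⟩⟩

/-- A map of prime spectra is continuous if preimages of the sets `V(y)` are again of this form. -/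
theorem continuous_specL {M N : Type*} [CompleteLattice M] [CompleteLattice N]
    {mul : M → M → M} {mul' : N → N → N} {f : SpecL mul → SpecL mul'} (k : N → M)
    (hk : ∀ y p, y ≤ (f p).1 ↔ k y ≤ p.1) : Continuous f := by
  refine continuous_generateFrom_iff.2 ?_
  rintro _ ⟨y, rfl⟩
  have h : f ⁻¹' (Vset mul' y)ᶜ = (Vset mul (k y))ᶜ := by
    ext p
    exact not_congr (hk y p)
  rw [h]
  exact (isClosed_Vset mul (k y)).isOpen_compl

/-- A map of prime spectra under which the sets `V(x)` correspond in both directions is an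
embedding. -/
theorem isEmbedding_specL {M N : Type*} [CompleteLattice M] [CompleteLattice N]
    {mul : M → M → M} {mul' : N → N → N} {f : SpecL mul → SpecL mul'} (k : N → M) (g : M → N)
    (hk : ∀ y p, y ≤ (f p).1 ↔ k y ≤ p.1) (hg : ∀ x p, g x ≤ (f p).1 ↔ x ≤ p.1) :
    Topology.IsEmbedding f := by
  refine ⟨⟨le_antisymm (continuous_specL k hk).le_induced (le_generateFrom ?_)⟩, ?_⟩
  · rintro _ ⟨x, rfl⟩
    refine isOpen_induced_iff.2 ⟨_, (isClosed_Vset mul' (g x)).isOpen_compl, ?_⟩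
    ext p
    exact not_congr (hg x p)
  · intro p q h
    refine Subtype.ext (le_antisymm ?_ ?_)
    · rw [← hg, ← h, hg]
    · rw [← hg, h, hg]

theorem primeElt_prodMul_iff {M N : Type*} [CompleteLattice M] [CompleteLattice N]
    (mul₁ : M → M → M) (mul₂ : N → N → N)
    (hmul₁ : ∀ x y : M, mul₁ x y ≤ x ⊓ y) (hmul₂ : ∀ x y : N, mul₂ x y ≤ x ⊓ y) (p : M × N) :
    PrimeElt (prodMul mul₁ mul₂) p ↔
      ((p.2 = ⊤ ∧ PrimeElt mul₁ p.1) ∨ (p.1 = ⊤ ∧ PrimeElt mul₂ p.2)) := by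
  obtain ⟨a, b⟩ := p
  constructor
  · rintro ⟨hne, hp⟩
    have h : ((⊤ : M), (⊥ : N)) ≤ (a, b) ∨ ((⊥ : M), (⊤ : N)) ≤ (a, b) :=
      hp _ _ ⟨((hmul₁ _ _).trans inf_le_right).trans bot_le,
        ((hmul₂ _ _).trans inf_le_left).trans bot_le⟩
    rcases h with h | h
    · obtain rfl : a = ⊤ := top_le_iff.1 h.1
      refine Or.inr ⟨rfl, fun hb => hne (Prod.ext rfl hb), fun x y hxy => ?_⟩
      exact (hp (⊤, x) (⊤, y) ⟨le_top, hxy⟩).imp And.right And.right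
    · obtain rfl : b = ⊤ := top_le_iff.1 h.2
      refine Or.inl ⟨rfl, fun ha => hne (Prod.ext ha rfl), fun x y hxy => ?_⟩
      exact (hp (x, ⊤) (y, ⊤) ⟨hxy, le_top⟩).imp And.left And.left
  · rintro (⟨hb, hne, hp⟩ | ⟨ha, hne, hp⟩)
    · obtain rfl : b = ⊤ := hb
      exact ⟨fun h => hne (congrArg Prod.fst h), fun x y hxy =>
        (hp x.1 y.1 hxy.1).imp (fun h => ⟨h, le_top⟩) (fun h => ⟨h, le_top⟩)⟩
    · obtain rfl : a = ⊤ := ha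
      exact ⟨fun h => hne (congrArg Prod.snd h), fun x y hxy =>
        (hp x.2 y.2 hxy.2).imp (fun h => ⟨le_top, h⟩) (fun h => ⟨le_top, h⟩)⟩

/-- The primes of `L₁ × L₂` are exactly the `(p₁, 1)` with `p₁` prime and the `(1, p₂)` with
`p₂` prime; `Spec (L₁ × L₂)` is the disjoint union of the clopen sets `V((0,1))` and
`V((1,0))`, homeomorphic to `Spec L₁` and `Spec L₂` respectively. -/
theorem spec_prod (mul₁ : L → L → L) {L₂ : Type*} [CompleteLattice L₂]
    (mul₂ : L₂ → L₂ → L₂)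
    (hmul₁ : ∀ x y : L, mul₁ x y ≤ x ⊓ y)
    (hmul₂ : ∀ x y : L₂, mul₂ x y ≤ x ⊓ y) :
    (∀ p : L × L₂, PrimeElt (prodMul mul₁ mul₂) p ↔
        ((p.2 = ⊤ ∧ PrimeElt mul₁ p.1) ∨ (p.1 = ⊤ ∧ PrimeElt mul₂ p.2))) ∧
    IsClopen (Vset (prodMul mul₁ mul₂) ((⊥ : L), (⊤ : L₂))) ∧
    IsClopen (Vset (prodMul mul₁ mul₂) ((⊤ : L), (⊥ : L₂))) ∧
    Vset (prodMul mul₁ mul₂) ((⊥ : L), (⊤ : L₂)) ∪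
        Vset (prodMul mul₁ mul₂) ((⊤ : L), (⊥ : L₂)) = Set.univ ∧
    Vset (prodMul mul₁ mul₂) ((⊥ : L), (⊤ : L₂)) ∩
        Vset (prodMul mul₁ mul₂) ((⊤ : L), (⊥ : L₂)) = ∅ ∧
    (∃ h : SpecL mul₁ ≃ₜ ↥(Vset (prodMul mul₁ mul₂) ((⊥ : L), (⊤ : L₂))),
        ∀ p : SpecL mul₁, ((h p).1).1 = (p.1, (⊤ : L₂))) ∧
    (∃ h : SpecL mul₂ ≃ₜ ↥(Vset (prodMul mul₁ mul₂) ((⊤ : L), (⊥ : L₂))),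
        ∀ p : SpecL mul₂, ((h p).1).1 = ((⊤ : L), p.1)) := by
  have key := primeElt_prodMul_iff mul₁ mul₂ hmul₁ hmul₂
  have hunion : Vset (prodMul mul₁ mul₂) ((⊥ : L), (⊤ : L₂)) ∪
      Vset (prodMul mul₁ mul₂) ((⊤ : L), (⊥ : L₂)) = Set.univ := by
    refine Set.eq_univ_of_forall fun p => ?_
    rcases (key p.1).1 p.2 with h | h
    · exact Or.inl ⟨bot_le, h.1.ge⟩
    · exact Or.inr ⟨h.1.ge, bot_le⟩
  have hinter : Vset (prodMul mul₁ mul₂) ((⊥ : L), (⊤ : L₂)) ∩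
      Vset (prodMul mul₁ mul₂) ((⊤ : L), (⊥ : L₂)) = ∅ := by
    refine Set.eq_empty_of_forall_notMem fun p hp => p.2.1 ?_
    exact Prod.ext (top_le_iff.1 hp.2.1) (top_le_iff.1 hp.1.2)
  have hcompl : IsCompl (Vset (prodMul mul₁ mul₂) ((⊥ : L), (⊤ : L₂)))
      (Vset (prodMul mul₁ mul₂) ((⊤ : L), (⊥ : L₂))) :=
    ⟨Set.disjoint_iff_inter_eq_empty.2 hinter, codisjoint_iff.2 hunion⟩
  refine ⟨key, ⟨isClosed_Vset _ _, ?_⟩, ⟨isClosed_Vset _ _, ?_⟩, hunion, hinter, ?_, ?_⟩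
  · rw [← hcompl.symm.compl_eq]
    exact (isClosed_Vset _ _).isOpen_compl
  · rw [← hcompl.compl_eq]
    exact (isClosed_Vset _ _).isOpen_compl
  · let f : SpecL mul₁ → SpecL (prodMul mul₁ mul₂) :=
      fun p => ⟨(p.1, ⊤), (key _).2 (Or.inl ⟨rfl, p.2⟩)⟩
    have hf : Topology.IsEmbedding f := isEmbedding_specL Prod.fst (fun x => (x, ⊥))
      (fun _ _ => and_iff_left le_top) (fun _ _ => and_iff_left le_top)
    have hrange : Set.range f = Vset (prodMul mul₁ mul₂) ((⊥ : L), (⊤ : L₂)) := by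
      refine Set.Subset.antisymm (Set.range_subset_iff.2 fun p => ⟨bot_le, le_rfl⟩) fun q hq => ?_
      have hq₂ : q.1.2 = ⊤ := top_le_iff.1 hq.2
      have hq₁ : PrimeElt mul₁ q.1.1 :=
        ((key q.1).1 q.2).elim And.right fun h => (h.2.1 hq₂).elim
      exact ⟨⟨q.1.1, hq₁⟩, Subtype.ext (Prod.ext rfl hq₂.symm)⟩
    exact ⟨hf.toHomeomorph.trans (Homeomorph.setCongr hrange), fun _ => rfl⟩
  · let f : SpecL mul₂ → SpecL (prodMul mul₁ mul₂) :=
      fun p => ⟨(⊤, p.1), (key _).2 (Or.inr ⟨rfl, p.2⟩)⟩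
    have hf : Topology.IsEmbedding f := isEmbedding_specL Prod.snd (fun x => (⊥, x))
      (fun _ _ => and_iff_right le_top) (fun _ _ => and_iff_right le_top)
    have hrange : Set.range f = Vset (prodMul mul₁ mul₂) ((⊤ : L), (⊥ : L₂)) := by
      refine Set.Subset.antisymm (Set.range_subset_iff.2 fun p => ⟨le_rfl, bot_le⟩) fun q hq => ?_
      have hq₁ : q.1.1 = ⊤ := top_le_iff.1 hq.1
      have hq₂ : PrimeElt mul₂ q.1.2 :=
        ((key q.1).1 q.2).elim (fun h => (h.2.1 hq₁).elim) And.right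
      exact ⟨⟨q.1.2, hq₂⟩, Subtype.ext (Prod.ext hq₁.symm rfl)⟩
    exact ⟨hf.toHomeomorph.trans (Homeomorph.setCongr hrange), fun _ => rfl⟩
end

section
/- Let L be an algebraic multiplicative lattice that satisfies the monotonicity condition, and let s ∈ L with s ≠ 1. Then s is semiprime if and only if S_s := {c ∈ C(L) : c ≰ s} is an n-system in L. -/
open CompleteLattice

variable {L : Type*} [CompleteLattice L]

/-- An *n-system* in a multiplicative lattice: a nonempty set of compact elements such that
for every `x ∈ S` there is `y ∈ S` with `y ≤ x·x`. -/
def IsNSystem (mul : L → L → L) (S : Set L) : Prop :=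
  S.Nonempty ∧ (∀ s ∈ S, IsCompactElement s) ∧ ∀ x ∈ S, ∃ y ∈ S, y ≤ mul x x

/-- If every element is a join of compact elements, then `x ≰ s` is witnessed by a compact
element below `x`. -/
theorem exists_isCompactElement_le_not_le
    (halg : ∀ x : L, ∃ s : Set L, (∀ c ∈ s, IsCompactElement c) ∧ x = sSup s)
    {x s : L} (h : ¬ x ≤ s) : ∃ c, IsCompactElement c ∧ c ≤ x ∧ ¬ c ≤ s := by
  obtain ⟨D, hD, rfl⟩ := halg x
  by_contra! H
  exact h (sSup_le fun c hc => H c (hD c hc) (le_sSup hc))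

/-- In an algebraic multiplicative lattice satisfying the monotonicity condition, an element
`s ≠ 1` is semiprime iff `S_s := {c ∈ C(L) | c ≰ s}` is an n-system. -/
theorem semiprime_iff_nsystem (mul : L → L → L)
    (hmul : ∀ x y : L, mul x y ≤ x ⊓ y)
    (hmono : ∀ x y x' y' : L, x ≤ y → x' ≤ y' → mul x x' ≤ mul y y')
    (halg : ∀ x : L, ∃ s : Set L, (∀ c ∈ s, IsCompactElement c) ∧ x = sSup s)
    (s : L) (hs : s ≠ ⊤) :
    (∀ x : L, mul x x ≤ s → x ≤ s) ↔
      IsNSystem mul {c : L | IsCompactElement c ∧ ¬ c ≤ s} := by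
  constructor
  · intro h
    refine ⟨?_, fun c hc => hc.1, fun x hx => ?_⟩
    · obtain ⟨c, hc, -, hcs⟩ :=
        exists_isCompactElement_le_not_le halg (mt top_le_iff.mp hs)
      exact ⟨c, hc, hcs⟩
    · obtain ⟨c, hc, hcx, hcs⟩ := exists_isCompactElement_le_not_le halg (mt (h x) hx.2)
      exact ⟨c, ⟨hc, hcs⟩, hcx⟩
  · rintro ⟨-, -, h⟩ x hx
    by_contra hxs
    obtain ⟨c, hc, hcx, hcs⟩ := exists_isCompactElement_le_not_le halg hxs
    obtain ⟨y, hy, hyc⟩ := h c ⟨hc, hcs⟩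
    exact hy.2 (hyc.trans ((hmono c x c x hcx hcx).trans hx))
end

section
/- (Lying-over) Let L be a multiplicative lattice with infinite m-distributivity and let n ∈ L. Then for every prime element q of the multiplicative lattice [0,n] := {z ∈ L : z ≤ n} (with the induced order and the restriction of the multiplication of L), there exists a unique prime element p ∈ Spec(L) such that p ∧ n = q. -/
open CompleteLattice TopologicalSpace

variable {L : Type*} [CompleteLattice L]

/-- A binary operation that preserves arbitrary suprema jointly is monotone in both arguments. -/
theorem mul_mono_of_sSup (mul : L → L → L)
    (hinf : ∀ X Y : Set L, mul (sSup X) (sSup Y) = sSup (Set.image2 mul X Y))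
    {a b c d : L} (hab : a ≤ b) (hcd : c ≤ d) : mul a c ≤ mul b d := by
  have h := hinf {a, b} {c, d}
  rw [sSup_pair, sSup_pair, sup_eq_right.2 hab, sup_eq_right.2 hcd] at h
  rw [h]
  exact le_sSup (Set.mem_image2_of_mem (by simp) (by simp))

/-- Lying-over: in a multiplicative lattice with infinite m-distributivity, for every prime
element `q` of the interval `[0, n]` (with the restricted multiplication) there is a unique
prime `p ∈ Spec L` with `p ⊓ n = q`. -/
theorem lying_over (mul : L → L → L)
    (hmul : ∀ x y : L, mul x y ≤ x ⊓ y)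
    (hinf : ∀ X Y : Set L, mul (sSup X) (sSup Y) = sSup (Set.image2 mul X Y))
    (n : L) (q : L) (hq : q ≤ n) (hqn : q ≠ n)
    (hqprime : ∀ x y : L, x ≤ n → y ≤ n → mul x y ≤ q → x ≤ q ∨ y ≤ q) :
    ∃! p : L, PrimeElt mul p ∧ p ⊓ n = q := by
  have hmono : ∀ {a b c d : L}, a ≤ b → c ≤ d → mul a c ≤ mul b d := mul_mono_of_sSup mul hinf
  have hle : ∀ x y : L, mul x y ≤ x := fun x y => (hmul x y).trans inf_le_left
  have hle' : ∀ x y : L, mul x y ≤ y := fun x y => (hmul x y).trans inf_le_right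
  set p : L := sSup {x | mul x n ≤ q} with hp
  have hpn : mul p n ≤ q := by
    have h := hinf {x | mul x n ≤ q} {n}
    rw [sSup_singleton] at h
    rw [hp, h]
    refine sSup_le ?_
    rintro _ ⟨x, hx, y, rfl, rfl⟩
    exact hx
  have hmem : ∀ x, x ≤ p ↔ mul x n ≤ q :=
    fun x => ⟨fun h => (hmono h le_rfl).trans hpn, fun h => le_sSup h⟩
  have hpq : p ⊓ n = q := by
    refine le_antisymm ?_ (le_inf ((hmem q).2 (hle q n)) hq)
    rcases hqprime (p ⊓ n) n inf_le_right le_rfl ((hmem _).1 inf_le_left) with h | h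
    · exact h
    · exact inf_le_right.trans h
  refine ⟨p, ⟨⟨fun h => hqn ?_, fun x y hxy => ?_⟩, hpq⟩, ?_⟩
  · rw [← hpq, h, top_inf_eq]
  · rw [hmem x, hmem y]
    refine hqprime _ _ (hle' x n) (hle' y n) ?_
    rw [← hpq]
    exact le_inf ((hmono (hle x n) (hle y n)).trans hxy) ((hle _ _).trans (hle' x n))
  · rintro p' ⟨⟨-, hprime⟩, hp'⟩
    have hnp' : ¬ n ≤ p' := fun h => hqn (by rw [← hp', inf_eq_right.2 h])
    refine eq_of_forall_le_iff fun x => ?_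
    rw [hmem, ← hp', le_inf_iff, and_iff_left (hle' x n)]
    exact ⟨(hle x n).trans, fun h => (hprime x n h).resolve_right hnp'⟩
end

section
/- Let L be a multiplicative lattice with infinite m-distributivity and let n ∈ L. Then the mapping φ: D_L(n) → Spec([0,n]), p ↦ p ∧ n, is a homeomorphism, where D_L(n) := Spec(L) \ V_L(n) carries the subspace topology from the Zariski topology on Spec(L), and Spec([0,n]) carries the Zariski topology of the multiplicative lattice [0,n]. -/
open CompleteLattice TopologicalSpace

variable {L : Type*} [CompleteLattice L]

/-- An element `q` of the interval `[0, n]` (with the restricted multiplication) is prime in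
`[0, n]`. -/
def PrimeIn (mul : L → L → L) (n q : L) : Prop :=
  q ≤ n ∧ q ≠ n ∧ ∀ x y : L, x ≤ n → y ≤ n → mul x y ≤ q → x ≤ q ∨ y ≤ q

/-- The prime spectrum of the interval `[0, n]`, as a type. -/
abbrev SpecIn (mul : L → L → L) (n : L) : Type _ := {q : L // PrimeIn mul n q}

/-- The Zariski topology on the spectrum of the interval `[0, n]`: the closed sets are the
`V(x)` for `x ∈ [0, n]`. -/
instance (mul : L → L → L) (n : L) : TopologicalSpace (SpecIn mul n) :=
  generateFrom {U : Set (SpecIn mul n) |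
    ∃ x : L, x ≤ n ∧ U = ({q : SpecIn mul n | x ≤ q.1})ᶜ}

/-- Infinite m-distributivity makes the multiplication monotone in both arguments. -/
theorem mul_mono_of_infinite_distrib {mul : L → L → L}
    (hinf : ∀ X Y : Set L, mul (sSup X) (sSup Y) = sSup (Set.image2 mul X Y))
    {a b c d : L} (hab : a ≤ b) (hcd : c ≤ d) : mul a c ≤ mul b d := by
  have h := hinf {a, b} {c, d}
  rw [sSup_pair, sSup_pair, sup_eq_right.2 hab, sup_eq_right.2 hcd] at h
  rw [h]
  exact le_sSup (Set.mem_image2_of_mem (by simp) (by simp))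

/-- The residual of `q` by `n`: the join of all `x` with `x·n ≤ q`. -/
def residualElt (mul : L → L → L) (n q : L) : L := sSup {x : L | mul x n ≤ q}

theorem le_residualElt_iff {mul : L → L → L}
    (hinf : ∀ X Y : Set L, mul (sSup X) (sSup Y) = sSup (Set.image2 mul X Y))
    {n q x : L} : x ≤ residualElt mul n q ↔ mul x n ≤ q := by
  refine ⟨fun hx => (mul_mono_of_infinite_distrib hinf hx le_rfl).trans ?_, fun hx => le_sSup hx⟩
  have h := hinf {x : L | mul x n ≤ q} {n}
  rw [sSup_singleton] at h
  rw [residualElt, h]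
  refine sSup_le ?_
  rintro _ ⟨a, ha, b, rfl, rfl⟩
  exact ha

theorem PrimeElt.inf_primeIn {mul : L → L → L} {n p : L} (hp : PrimeElt mul p)
    (hn : ¬ n ≤ p) : PrimeIn mul n (p ⊓ n) :=
  ⟨inf_le_right, fun h => hn (inf_eq_right.1 h), fun x y hx hy hxy =>
    (hp.2 x y (hxy.trans inf_le_left)).imp (le_inf · hx) (le_inf · hy)⟩

theorem PrimeIn.residualElt_inf {mul : L → L → L}
    (hmul : ∀ x y : L, mul x y ≤ x ⊓ y)
    (hinf : ∀ X Y : Set L, mul (sSup X) (sSup Y) = sSup (Set.image2 mul X Y))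
    {n q : L} (hq : PrimeIn mul n q) : residualElt mul n q ⊓ n = q := by
  refine le_antisymm ?_
    (le_inf ((le_residualElt_iff hinf).2 ((hmul q n).trans inf_le_left)) hq.1)
  exact or_self_iff.1 <| hq.2.2 _ _ inf_le_right inf_le_right <|
    (mul_mono_of_infinite_distrib hinf inf_le_left inf_le_right).trans
      ((le_residualElt_iff hinf).1 le_rfl)

theorem PrimeIn.not_le_residualElt {mul : L → L → L}
    (hmul : ∀ x y : L, mul x y ≤ x ⊓ y)
    (hinf : ∀ X Y : Set L, mul (sSup X) (sSup Y) = sSup (Set.image2 mul X Y))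
    {n q : L} (hq : PrimeIn mul n q) : ¬ n ≤ residualElt mul n q := fun h =>
  hq.2.1 ((hq.residualElt_inf hmul hinf).symm.trans (inf_eq_right.2 h))

theorem PrimeIn.residualElt_primeElt {mul : L → L → L}
    (hmul : ∀ x y : L, mul x y ≤ x ⊓ y)
    (hinf : ∀ X Y : Set L, mul (sSup X) (sSup Y) = sSup (Set.image2 mul X Y))
    {n q : L} (hq : PrimeIn mul n q) : PrimeElt mul (residualElt mul n q) := by
  refine ⟨fun h => hq.not_le_residualElt hmul hinf (h ▸ le_top), fun a b hab => ?_⟩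
  have right_le (x : L) : mul x n ≤ n := (hmul x n).trans inf_le_right
  have left_le (x : L) : mul x n ≤ x := (hmul x n).trans inf_le_left
  have hzn : mul (mul a n) (mul b n) ≤ n := ((hmul _ _).trans inf_le_left).trans (right_le a)
  have hz : mul (mul a n) (mul b n) ≤ q := or_self_iff.1 <| hq.2.2 _ _ hzn hzn <|
    (mul_mono_of_infinite_distrib hinf
      (mul_mono_of_infinite_distrib hinf (left_le a) (left_le b)) hzn).trans
      ((le_residualElt_iff hinf).1 hab)
  simpa only [le_residualElt_iff hinf] using hq.2.2 _ _ (right_le a) (right_le b) hz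

theorem PrimeElt.residualElt_inf {mul : L → L → L}
    (hmul : ∀ x y : L, mul x y ≤ x ⊓ y)
    (hinf : ∀ X Y : Set L, mul (sSup X) (sSup Y) = sSup (Set.image2 mul X Y))
    {n p : L} (hp : PrimeElt mul p) (hn : ¬ n ≤ p) : residualElt mul n (p ⊓ n) = p := by
  refine eq_of_forall_le_iff fun x => ?_
  rw [le_residualElt_iff hinf]
  exact ⟨fun h => (hp.2 x n (h.trans inf_le_left)).resolve_right hn,
    fun h => (hmul x n).trans (inf_le_inf_right n h)⟩

/-- For a multiplicative lattice `L` with infinite m-distributivity and `n ∈ L`, the map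
`p ↦ p ⊓ n` is a homeomorphism of `D_L(n) = Spec L \ V_L(n)` onto `Spec [0, n]`. -/
theorem open_subset_is_spectrum (mul : L → L → L)
    (hmul : ∀ x y : L, mul x y ≤ x ⊓ y)
    (hinf : ∀ X Y : Set L, mul (sSup X) (sSup Y) = sSup (Set.image2 mul X Y))
    (n : L) :
    ∃ h : ↥((Vset mul n)ᶜ) ≃ₜ SpecIn mul n,
      ∀ p : ↥((Vset mul n)ᶜ), (h p).1 = (p.1).1 ⊓ n := by
  refine ⟨{
    toFun := fun p => ⟨p.1.1 ⊓ n, p.1.2.inf_primeIn p.2⟩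
    invFun := fun q => ⟨⟨residualElt mul n q.1, q.2.residualElt_primeElt hmul hinf⟩,
      q.2.not_le_residualElt hmul hinf⟩
    left_inv := fun p => Subtype.ext (Subtype.ext (p.1.2.residualElt_inf hmul hinf p.2))
    right_inv := fun q => Subtype.ext (q.2.residualElt_inf hmul hinf)
    continuous_toFun := ?_
    continuous_invFun := ?_ }, fun _ => rfl⟩
  · refine continuous_generateFrom_iff.2 ?_
    rintro _ ⟨x, hx, rfl⟩
    refine ⟨(Vset mul x)ᶜ, isOpen_generateFrom_of_mem ⟨x, rfl⟩, ?_⟩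
    ext p
    simp [Vset, hx]
  · refine Continuous.subtype_mk (continuous_generateFrom_iff.2 ?_) _
    rintro _ ⟨x, rfl⟩
    refine isOpen_generateFrom_of_mem ⟨mul x n, (hmul x n).trans inf_le_right, ?_⟩
    ext q
    simp [Vset, le_residualElt_iff hinf]
end
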